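/- Eigenvalues of the principal symbol of the Type IIA flow: the operator L maps W into itself, and the restriction L|_W is diagonalizable with eigenvalue 1 of multiplicity 4 and eigenvalue 0 of multiplicity 1; explicitly, the kernel of L|_W is spanned by f¹∧f⁴ + f²∧f³, and the eigenspace of L|_W for the eigenvalue 1 is spanned by f¹∧f² − f³∧f⁴, f¹∧f³ + f²∧f⁴, f¹∧f⁴ − f²∧f³, and f¹∧f³ − f²∧f⁴. -/

import Mathlib

noncomputable section

/-- The underlying vector space `ℝ⁴`. -/
abbrev V4 : Type := Fin 4 → ℝ

/-- The standard basis `f₁, …, f₄` of `ℝ⁴` (zero-indexed). -/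
def f4 (i : Fin 4) : V4 := fun j => if j = i then (1 : ℝ) else 0

/-- The space of 2-forms on `ℝ⁴`. -/
abbrev Lam2 : Type := AlternatingMap ℝ V4 ℝ (Fin 2)

/-- Projection onto two coordinates, used to build `f^a ∧ f^b`. -/
def proj2 (a b : Fin 4) : V4 →ₗ[ℝ] (Fin 2 → ℝ) where
  toFun x := ![x a, x b]
  map_add' x y := by
    funext i; fin_cases i <;> simp
  map_smul' r x := by
    funext i; fin_cases i <;> simp

/-- The basic 2-form `f^a ∧ f^b`. -/
def w2 (a b : Fin 4) : Lam2 :=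
  (Matrix.detRowAlternating : AlternatingMap ℝ (Fin 2 → ℝ) ℝ (Fin 2)).compLinearMap (proj2 a b)

/-- The complex structure `J` with `Jf₁ = f₂, Jf₂ = −f₁, Jf₃ = f₄, Jf₄ = −f₃`. -/
def J4 : V4 →ₗ[ℝ] V4 where
  toFun x := ![-x 1, x 0, -x 3, x 2]
  map_add' x y := by
    funext i; fin_cases i <;> simp <;> ring
  map_smul' r x := by
    funext i; fin_cases i <;> simp

/-- The inner product on 2-forms for which `{f^i∧f^j : i < j}` is an orthonormal basis. -/
def inner2 (γ η : Lam2) : ℝ :=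
  ∑ i : Fin 4, ∑ j : Fin 4, if i < j then γ ![f4 i, f4 j] * η ![f4 i, f4 j] else 0

/-- `σ₁ = f¹∧f⁴ + f²∧f³`. -/
def sig1 : Lam2 := w2 0 3 + w2 1 2

/-- `σ₂ = f¹∧f³ − f²∧f⁴`. -/
def sig2 : Lam2 := w2 0 2 - w2 1 3

/-- The principal symbol operator `L(γ) = γ∘(J×J) + (1/2)⟨γ,σ₁⟩σ₁ + ⟨γ,σ₂⟩σ₂`. -/
def Lop (γ : Lam2) : Lam2 :=
  γ.compLinearMap J4 + ((1 / 2 : ℝ) * inner2 γ sig1) • sig1 + inner2 γ sig2 • sig2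

/-- The space `W` of `ω'`-primitive 2-forms. -/
def Wprim : Set Lam2 := {γ | γ ![f4 0, f4 1] + γ ![f4 2, f4 3] = 0}

lemma lam2_swap (γ : Lam2) (x y : V4) : γ ![y, x] = -γ ![x, y] := by
  have := γ.map_swap ![x, y] (i := 0) (j := 1) (by decide)
  rw [← this]
  congr 1
  ext k : 1
  fin_cases k <;> simp

/-- Two 2-forms agreeing on the pairs `(f_i, f_j)` with `i < j` are equal. -/
lemma lam2_ext {γ η : Lam2}
    (h : ∀ i j : Fin 4, i < j → γ ![f4 i, f4 j] = η ![f4 i, f4 j]) : γ = η := by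
  have f4_eq (i : Fin 4) : f4 i = Pi.basisFun ℝ (Fin 4) i := by
    ext j
    simp [f4, Pi.single_apply]
  refine Module.Basis.ext_alternating (Pi.basisFun ℝ (Fin 4)) fun v hv => ?_
  have hvec : (fun i => Pi.basisFun ℝ (Fin 4) (v i)) = ![f4 (v 0), f4 (v 1)] := by
    ext k : 1
    fin_cases k <;> simp [f4_eq]
  rw [hvec]
  rcases lt_or_gt_of_ne (hv.ne (by decide : (0 : Fin 2) ≠ 1)) with hlt | hlt
  · exact h _ _ hlt
  · rw [lam2_swap γ, lam2_swap η, h _ _ hlt]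

lemma lam2_ext_iff {γ η : Lam2} : γ = η ↔
    γ ![f4 0, f4 1] = η ![f4 0, f4 1] ∧ γ ![f4 0, f4 2] = η ![f4 0, f4 2] ∧
    γ ![f4 0, f4 3] = η ![f4 0, f4 3] ∧ γ ![f4 1, f4 2] = η ![f4 1, f4 2] ∧
    γ ![f4 1, f4 3] = η ![f4 1, f4 3] ∧ γ ![f4 2, f4 3] = η ![f4 2, f4 3] := by
  constructor
  · rintro rfl
    simp
  · rintro ⟨h01, h02, h03, h12, h13, h23⟩
    refine lam2_ext fun i j hij => ?_
    fin_cases i <;> fin_cases j <;> first | assumption | exact absurd hij (by decide)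

lemma w2_apply (a b : Fin 4) (x y : V4) : w2 a b ![x, y] = x a * y b - y a * x b := by
  refine (Matrix.det_fin_two (Matrix.of fun i => proj2 a b (![x, y] i))).trans ?_
  simp [proj2]
  ring

lemma w2_apply_f4 (a b i j : Fin 4) : w2 a b ![f4 i, f4 j] =
    (if a = i then 1 else 0) * (if b = j then 1 else 0) -
      (if a = j then 1 else 0) * (if b = i then 1 else 0) := by
  rw [w2_apply]
  rfl

lemma inner2_sig1 (γ : Lam2) :
    inner2 γ sig1 = γ ![f4 0, f4 3] + γ ![f4 1, f4 2] := by
  simp [inner2, sig1, w2_apply_f4, Fin.sum_univ_four]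

lemma inner2_sig2 (γ : Lam2) :
    inner2 γ sig2 = γ ![f4 0, f4 2] - γ ![f4 1, f4 3] := by
  simp [inner2, sig2, w2_apply_f4, Fin.sum_univ_four]
  ring

lemma J4_f4_zero : J4 (f4 0) = f4 1 := by
  ext k
  fin_cases k <;> simp [J4, f4]

lemma J4_f4_one : J4 (f4 1) = -f4 0 := by
  ext k
  fin_cases k <;> simp [J4, f4]

lemma J4_f4_two : J4 (f4 2) = f4 3 := by
  ext k
  fin_cases k <;> simp [J4, f4]

lemma J4_f4_three : J4 (f4 3) = -f4 2 := by
  ext k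
  fin_cases k <;> simp [J4, f4]

lemma lam2_neg_left (γ : Lam2) (x y : V4) : γ ![-x, y] = -γ ![x, y] := by
  have h := γ.map_update_neg ![x, y] 0 x
  rw [show Function.update ![x, y] 0 x = ![x, y] from Function.update_eq_self 0 ![x, y]] at h
  rw [← h]
  congr 1
  ext k : 1
  fin_cases k <;> simp

lemma lam2_neg_right (γ : Lam2) (x y : V4) : γ ![x, -y] = -γ ![x, y] := by
  have h := γ.map_update_neg ![x, y] 1 y
  rw [show Function.update ![x, y] 1 y = ![x, y] from Function.update_eq_self 1 ![x, y]] at h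
  rw [← h]
  congr 1
  ext k : 1
  fin_cases k <;> simp

lemma Lop_apply (γ : Lam2) (x y : V4) : Lop γ ![x, y] =
    γ ![J4 x, J4 y] + 1 / 2 * (γ ![f4 0, f4 3] + γ ![f4 1, f4 2]) * sig1 ![x, y] +
      (γ ![f4 0, f4 2] - γ ![f4 1, f4 3]) * sig2 ![x, y] := by
  have hvec : (fun i => J4 (![x, y] i)) = ![J4 x, J4 y] := by
    ext k : 1
    fin_cases k <;> simp
  simp [Lop, inner2_sig1, inner2_sig2, hvec]

/-- The values of `Lop γ` on the pairs of basis vectors. -/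
lemma Lop_apply_f4 (γ : Lam2) :
    Lop γ ![f4 0, f4 1] = γ ![f4 0, f4 1] ∧
    Lop γ ![f4 0, f4 2] = γ ![f4 0, f4 2] ∧
    Lop γ ![f4 0, f4 3] = (γ ![f4 0, f4 3] - γ ![f4 1, f4 2]) / 2 ∧
    Lop γ ![f4 1, f4 2] = (γ ![f4 1, f4 2] - γ ![f4 0, f4 3]) / 2 ∧
    Lop γ ![f4 1, f4 3] = γ ![f4 1, f4 3] ∧
    Lop γ ![f4 2, f4 3] = γ ![f4 2, f4 3] := by
  have h01 := lam2_swap γ (f4 0) (f4 1)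
  have h23 := lam2_swap γ (f4 2) (f4 3)
  refine ⟨?_, ?_, ?_, ?_, ?_, ?_⟩ <;>
    simp [Lop_apply, J4_f4_zero, J4_f4_one, J4_f4_two, J4_f4_three, lam2_neg_left,
      lam2_neg_right, sig1, sig2, w2_apply_f4] <;> linarith

lemma mem_Wprim_iff (γ : Lam2) : γ ∈ Wprim ↔ γ ![f4 0, f4 1] + γ ![f4 2, f4 3] = 0 :=
  Iff.rfl

lemma sig1_ne_zero : sig1 ≠ 0 := fun h => by
  have := (lam2_ext_iff.1 h).2.2.1
  simp [sig1, w2_apply_f4] at this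

lemma linearIndependent_eigenforms :
    LinearIndependent ℝ ![w2 0 1 - w2 2 3, w2 0 2 + w2 1 3, w2 0 3 - w2 1 2, sig2] := by
  rw [Fintype.linearIndependent_iff]
  intro g hg
  obtain ⟨h01, h02, h03, -, h13, -⟩ := lam2_ext_iff.1 hg
  simp [Fin.sum_univ_four, sig2, w2_apply_f4] at h01 h02 h03 h13
  intro i
  fin_cases i <;> simp <;> linarith

/-- `L` maps `W` into itself; on `W` it is diagonalizable (it satisfies
`L² = L` on `W`) with eigenvalue 1 of multiplicity 4 and eigenvalue 0 of multiplicity 1: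
the kernel of `L|_W` is spanned by `f¹∧f⁴ + f²∧f³`, and the eigenspace for eigenvalue 1
is spanned by `f¹∧f² − f³∧f⁴, f¹∧f³ + f²∧f⁴, f¹∧f⁴ − f²∧f³, f¹∧f³ − f²∧f⁴`. -/
theorem principal_symbol_eigenvalues :
    (∀ γ ∈ Wprim, Lop γ ∈ Wprim) ∧
    (∀ γ ∈ Wprim, Lop (Lop γ) = Lop γ) ∧
    ({γ | γ ∈ Wprim ∧ Lop γ = 0} = (Submodule.span ℝ ({sig1} : Set Lam2) : Set Lam2)) ∧
    ({γ | γ ∈ Wprim ∧ Lop γ = γ}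
      = (Submodule.span ℝ ({w2 0 1 - w2 2 3, w2 0 2 + w2 1 3, w2 0 3 - w2 1 2, sig2} :
          Set Lam2) : Set Lam2)) ∧
    Module.finrank ℝ (Submodule.span ℝ ({sig1} : Set Lam2)) = 1 ∧
    Module.finrank ℝ
      (Submodule.span ℝ ({w2 0 1 - w2 2 3, w2 0 2 + w2 1 3, w2 0 3 - w2 1 2, sig2} :
        Set Lam2)) = 4 := by
  refine ⟨fun γ hγ => ?_, fun γ _ => ?_, ?_, ?_, finrank_span_singleton sig1_ne_zero, ?_⟩
  · obtain ⟨h01, -, -, -, -, h23⟩ := Lop_apply_f4 γ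
    rwa [mem_Wprim_iff, h01, h23]
  · obtain ⟨h01, h02, h03, h12, h13, h23⟩ := Lop_apply_f4 γ
    obtain ⟨k01, k02, k03, k12, k13, k23⟩ := Lop_apply_f4 (Lop γ)
    refine lam2_ext_iff.2 ⟨k01, k02, ?_, ?_, k13, k23⟩ <;> linarith
  · ext γ
    obtain ⟨h01, h02, h03, h12, h13, h23⟩ := Lop_apply_f4 γ
    rw [Set.mem_ofPred_eq, SetLike.mem_coe, Submodule.mem_span_singleton, mem_Wprim_iff,
      lam2_ext_iff, h01, h02, h03, h12, h13, h23]
    simp only [AlternatingMap.zero_apply]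
    constructor
    · rintro ⟨-, g01, g02, g03, -, g13, g23⟩
      refine ⟨γ ![f4 0, f4 3], lam2_ext_iff.2 ⟨?_, ?_, ?_, ?_, ?_, ?_⟩⟩ <;>
        simp [sig1, w2_apply_f4] <;> linarith
    · rintro ⟨a, rfl⟩
      simp [sig1, w2_apply_f4]
  · ext γ
    obtain ⟨h01, h02, h03, h12, h13, h23⟩ := Lop_apply_f4 γ
    rw [Set.mem_ofPred_eq, SetLike.mem_coe, mem_Wprim_iff,
      lam2_ext_iff, h01, h02, h03, h12, h13, h23]
    simp only [Submodule.mem_span_insert, Submodule.mem_span_singleton]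
    constructor
    · rintro ⟨hW, -, -, g03, -, -, -⟩
      refine ⟨γ ![f4 0, f4 1], _, ⟨(γ ![f4 0, f4 2] + γ ![f4 1, f4 3]) / 2, _,
        ⟨γ ![f4 0, f4 3], _, ⟨(γ ![f4 0, f4 2] - γ ![f4 1, f4 3]) / 2, rfl⟩, rfl⟩, rfl⟩, ?_⟩
      refine lam2_ext_iff.2 ⟨?_, ?_, ?_, ?_, ?_, ?_⟩ <;>
        simp [sig2, w2_apply_f4] <;> linarith
    · rintro ⟨a, _, ⟨b, _, ⟨c, _, ⟨d, rfl⟩, rfl⟩, rfl⟩, rfl⟩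
      simp [sig2, w2_apply_f4]
      ring
  · have h := finrank_span_eq_card linearIndependent_eigenforms
    rwa [Matrix.range_cons, Matrix.range_cons, Matrix.range_cons, Matrix.range_cons,
      Matrix.range_empty, Set.union_empty, Set.singleton_union, Set.singleton_union,
      Set.singleton_union, Fintype.card_fin] at h
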